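/- arXiv:hep-th/0610177 — 5 statements merged into one kernel-verified Lean document; each statement's English description precedes it below -/
import Mathlib

section
/- Let A be a C*-ring, i.e. a normed ring with a star ring structure satisfying the C*-identity ‖star x * x‖ = ‖x‖^2 for all x. If I is a two-sided ideal of A every element of which is nilpotent (for each x ∈ I there is n ≥ 1 with x^n = 0), then I is the zero ideal. -/
/-- Powers of an element in a (possibly non-unital) ring: `nupow x n = x ^ n` for `n ≥ 1`,
with the (irrelevant) convention `nupow x 0 = 0`. -/
def nupow {A : Type*} [Mul A] [Zero A] (x : A) : ℕ → A
  | 0 => 0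
  | 1 => x
  | n + 2 => nupow x (n + 1) * x

theorem nupow_comm_aux {A : Type*} [NonUnitalRing A] (y : A) (k : ℕ) :
    y * nupow y (k + 1) = nupow y (k + 1) * y := by
  induction k with
  | zero => rfl
  | succ k ih =>
    change y * (nupow y (k + 1) * y) = (nupow y (k + 1) * y) * y
    rw [← mul_assoc, ih]

theorem nupow_star_aux {A : Type*} [NonUnitalRing A] [StarRing A] (y : A) (hy : star y = y)
    (k : ℕ) : star (nupow y (k + 1)) = nupow y (k + 1) := by
  induction k with
  | zero => exact hy
  | succ k ih =>
    change star (nupow y (k + 1) * y) = nupow y (k + 1) * y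
    rw [star_mul, hy, ih, nupow_comm_aux]

theorem nupow_zero_aux {A : Type*} [NonUnitalRing A] (z y : A) (h : z * y = 0) (k : ℕ) :
    z * nupow y (k + 1) = 0 := by
  induction k with
  | zero => exact h
  | succ k ih =>
    change z * (nupow y (k + 1) * y) = 0
    rw [← mul_assoc, ih, zero_mul]

theorem nupow_selfAdjoint_aux {A : Type*} [NonUnitalNormedRing A] [StarRing A]
    [CStarRing A] (y : A) (hy : star y = y) (k : ℕ) (h : nupow y (k + 1) = 0) : y = 0 := by
  induction k with
  | zero => exact h
  | succ k ih =>
    apply ih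
    rw [← CStarRing.star_mul_self_eq_zero_iff, nupow_star_aux y hy]
    exact nupow_zero_aux _ y h k

/-- A C*-ring has no non-zero nilpotent two-sided ideals: a two-sided ideal all of whose
elements are nilpotent is the zero ideal. -/
theorem twoSidedIdeal_nilpotent_eq_bot {A : Type*} [NonUnitalNormedRing A] [StarRing A]
    [CStarRing A] (I : TwoSidedIdeal A)
    (hnil : ∀ x ∈ I, ∃ n : ℕ, 1 ≤ n ∧ nupow x n = 0) : I = ⊥ := by
  rw [eq_bot_iff]
  intro x hx
  rw [TwoSidedIdeal.mem_bot]
  obtain ⟨n, hn, h⟩ := hnil _ (I.mul_mem_left (star x) x hx)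
  obtain ⟨k, rfl⟩ := Nat.exists_eq_add_of_le' hn
  rw [← CStarRing.star_mul_self_eq_zero_iff]
  exact nupow_selfAdjoint_aux _ (by simp) k h
end

section
/- Let A be a finite-dimensional real C*-algebra (finite-dimensional as an ℝ-vector space). Then there exist k ∈ ℕ, ranks n : Fin k → ℕ, and algebras D : Fin k → Type with each D i equal to ℝ, ℂ, or the quaternions ℍ (each with its standard star structure, i.e. the identity on ℝ and conjugation on ℂ and ℍ), together with a star ℝ-algebra isomorphism A ≃⋆ₐ[ℝ] Π i, Matrix (Fin (n i)) (Fin (n i)) (D i), where each matrix algebra carries the conjugate-transpose star. -/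
/-- The three finite-dimensional real division algebras `ℝ`, `ℂ`, `ℍ`. -/
inductive RCHType : Type
  | R : RCHType
  | C : RCHType
  | H : RCHType

/-- The underlying type of each of `ℝ`, `ℂ`, `ℍ`. -/
def RCHType.carrier : RCHType → Type
  | .R => ℝ
  | .C => ℂ
  | .H => Quaternion ℝ

noncomputable instance (d : RCHType) : Ring d.carrier :=
  match d with
  | .R => inferInstanceAs (Ring ℝ)
  | .C => inferInstanceAs (Ring ℂ)
  | .H => inferInstanceAs (Ring (Quaternion ℝ))

/-- The standard star structure: the identity on `ℝ`, complex conjugation on `ℂ`,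
and quaternion conjugation on `ℍ`. -/
noncomputable instance (d : RCHType) : StarRing d.carrier :=
  match d with
  | .R => inferInstanceAs (StarRing ℝ)
  | .C => inferInstanceAs (StarRing ℂ)
  | .H => inferInstanceAs (StarRing (Quaternion ℝ))

noncomputable instance (d : RCHType) : Algebra ℝ d.carrier :=
  match d with
  | .R => inferInstanceAs (Algebra ℝ ℝ)
  | .C => inferInstanceAs (Algebra ℝ ℂ)
  | .H => inferInstanceAs (Algebra ℝ (Quaternion ℝ))

section RealCStar

set_option linter.unusedSectionVars false

variable {A : Type*} [NormedRing A] [StarRing A] [CStarRing A] [NormedAlgebra ℝ A]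
    [StarModule ℝ A]

lemma rc_sa_pow_eq_zero {h : A} (hs : star h = h) : ∀ m : ℕ, h ^ m = 0 → h = 0 ∨ (1 : A) = 0 := by
  intro m
  induction m using Nat.strong_induction_on with
  | _ m ih =>
    intro hm
    rcases Nat.eq_zero_or_pos m with rfl | hpos
    · right; simpa using hm
    · by_cases h1 : m = 1
      · left; simpa [h1] using hm
      · have h2 : h ^ (m - 1) = 0 := by
          rw [← CStarRing.star_mul_self_eq_zero_iff, star_pow, hs, ← pow_add]
          have : m - 1 + (m - 1) = m + (m - 2) := by omega
          rw [this, pow_add, hm, zero_mul]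
        exact ih (m - 1) (by omega) h2

lemma rc_sa_quad_unit (hinv : ∀ x : A, IsUnit (1 + star x * x)) {h : A} (hs : star h = h)
    (a b : ℝ) (hb : b ≠ 0) :
    IsUnit ((h - a • (1 : A)) * (h - a • (1 : A)) + (b ^ 2) • (1 : A)) := by
  have := hinv (b⁻¹ • (h - a • (1 : A)))
  have hst : star (h - a • (1 : A)) = h - a • (1 : A) := by simp [hs]
  rw [star_smul, hst, star_trivial, smul_mul_smul_comm] at this
  have h2 : (h - a • (1 : A)) * (h - a • (1 : A)) + (b ^ 2) • (1 : A)
      = (algebraMap ℝ A (b ^ 2)) *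
        (1 + (b⁻¹ * b⁻¹) • ((h - a • (1 : A)) * (h - a • (1 : A)))) := by
    rw [← Algebra.smul_def, smul_add, smul_smul]
    have : b ^ 2 * (b⁻¹ * b⁻¹) = 1 := by field_simp
    rw [this, one_smul, add_comm]
  rw [h2]
  exact ((isUnit_iff_ne_zero.mpr (pow_ne_zero 2 hb)).map (algebraMap ℝ A)).mul this

open Polynomial in
lemma rc_star_aeval {h : A} (hs : star h = h) (g : ℝ[X]) : star (aeval h g) = aeval h g := by
  induction g using Polynomial.induction_on' with
  | add p q hp hq => simp [hp, hq]
  | monomial n a =>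
    simp [aeval_monomial, ← Algebra.smul_def, hs]

open Polynomial in
/-- an irreducible factor `r` of an annihilating polynomial, `r(h) y = 0`, `y ≠ 0`, is linear -/
lemma rc_exists_root (hinv : ∀ x : A, IsUnit (1 + star x * x)) {h : A} (hs : star h = h)
    (r : ℝ[X]) (hr : Irreducible r) (y : A) (hy : y ≠ 0) (hry : aeval h r * y = 0) :
    ∃ c : ℝ, r.IsRoot c := by
  by_contra hno
  push Not at hno
  -- complex root
  have hdeg : 0 < r.degree := hr.degree_pos
  obtain ⟨z, hz⟩ := IsAlgClosed.exists_aeval_eq_zero ℂ r hdeg.ne'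
  have hzim : z.im ≠ 0 := by
    intro h0
    have : z = ((z.re : ℝ) : ℂ) := by apply Complex.ext <;> simp [h0]
    rw [this] at hz
    apply hno z.re
    have h3 : aeval (algebraMap ℝ ℂ z.re) r = 0 := hz
    rw [aeval_algebraMap_apply] at h3
    simpa [IsRoot, aeval_def] using h3
  have hdvd := Polynomial.quadratic_dvd_of_aeval_eq_zero_im_ne_zero r hz hzim
  obtain ⟨s, hs'⟩ := hdvd
  have hu : IsUnit s := by
    refine (hr.isUnit_or_isUnit hs').resolve_left ?_
    intro hunit
    have := natDegree_eq_zero_of_isUnit hunit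
    have h2 : (X ^ 2 - C (2 * z.re) * X + C (‖z‖ ^ 2)).natDegree = 2 := by compute_degree!
    omega
  have hq := rc_sa_quad_unit hinv hs z.re z.im hzim
  have hE : aeval h (X ^ 2 - C (2 * z.re) * X + C (‖z‖ ^ 2))
      = (h - z.re • (1 : A)) * (h - z.re • (1 : A)) + (z.im ^ 2) • (1 : A) := by
    have hn : ‖z‖ ^ 2 = z.re ^ 2 + z.im ^ 2 := by
      rw [← Complex.normSq_eq_norm_sq, Complex.normSq_apply]; ring
    rw [hn]
    simp only [map_add, map_sub, map_mul, aeval_X, aeval_C, map_pow, Algebra.algebraMap_eq_smul_one]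
    simp only [sub_mul, mul_sub, smul_mul_assoc, mul_smul_comm, one_mul, mul_one, pow_two, smul_smul]
    module
  have hU : IsUnit (aeval h r) := by
    rw [hs', map_mul, hE]
    exact hq.mul (hu.map (aeval h))
  exact hy ((hU.mul_right_eq_zero).1 hry)

open Polynomial in
lemma rc_spectral [FiniteDimensional ℝ A] (hinv : ∀ x : A, IsUnit (1 + star x * x)) {h : A}
    (hs : star h = h) (h0 : h ≠ 0) :
    ∃ (c : ℝ) (q : A), c ≠ 0 ∧ q ≠ 0 ∧ q * q = q ∧ star q = q ∧ h * q = c • q ∧ q * h = c • q := by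
  have h1 : (1 : A) ≠ 0 := fun h1 => h0 (by rw [← mul_one h, h1, mul_zero])
  have h_integral : IsIntegral ℝ h := Algebra.IsIntegral.isIntegral h
  set p := minpoly ℝ h with hp
  have hp0 : p ≠ 0 := minpoly.ne_zero h_integral
  have hph : aeval h p = 0 := minpoly.aeval ℝ h
  obtain ⟨r, hr, hnd⟩ := Polynomial.exists_eq_pow_rootMultiplicity_mul_and_not_dvd p hp0 0
  set m := rootMultiplicity 0 p
  have hr0 : r ≠ 0 := by rintro rfl; simp at hnd
  have hrnu : ¬ IsUnit r := by
    intro hu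
    rw [hr, map_mul] at hph
    have := ((hu.map (aeval h)).mul_left_eq_zero).1 hph
    simp only [map_zero, sub_zero, map_pow, aeval_X] at this
    rcases rc_sa_pow_eq_zero hs _ this with h | h
    · exact h0 h
    · exact h1 h
  obtain ⟨s, hsirr, t, rfl⟩ := WfDvdMonoid.exists_irreducible_factor hrnu hr0
  set g := (X - C 0) ^ m * t with hg
  have hpg : p = s * g := by rw [hr, hg]; ring
  have hg0 : g ≠ 0 := by rintro h; rw [h, mul_zero] at hpg; exact hp0 hpg
  have hgh : aeval h g ≠ 0 := by
    intro hz
    have h2 := minpoly.dvd ℝ h hz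
    rw [← hp, hpg] at h2
    have h3 : s * g ∣ 1 * g := by simpa using h2
    exact hsirr.not_isUnit (isUnit_of_dvd_one ((mul_dvd_mul_iff_right hg0).1 h3))
  have hsg : aeval h s * aeval h g = 0 := by rw [← map_mul, ← hpg, hph]
  obtain ⟨c, hc⟩ := rc_exists_root hinv hs s hsirr _ hgh hsg
  obtain ⟨u, hu⟩ := dvd_iff_isRoot.2 hc
  have huu : IsUnit u := by
    refine (hsirr.isUnit_or_isUnit hu).resolve_left ?_
    exact not_isUnit_X_sub_C c
  have hc0 : c ≠ 0 := by
    rintro rfl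
    exact hnd (Dvd.dvd.mul_right (dvd_iff_isRoot.2 hc) t)
  set y := aeval h g with hy
  have hhy : h * y = c • y := by
    rw [hu, mul_comm, map_mul, mul_assoc] at hsg
    have h4 := ((huu.map (aeval h)).mul_right_eq_zero).1 hsg
    simp only [map_sub, aeval_X, aeval_C, sub_mul, ← Algebra.smul_def] at h4
    exact sub_eq_zero.1 h4
  have hpow : ∀ n : ℕ, h ^ n * y = c ^ n • y := by
    intro n
    induction n with
    | zero => simp
    | succ n ih => rw [pow_succ, mul_assoc, hhy, mul_smul_comm, ih, smul_smul, pow_succ, mul_comm]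
  have hev : ∀ f : ℝ[X], aeval h f * y = (f.eval c) • y := by
    intro f
    induction f using Polynomial.induction_on' with
    | add p q hp hq => rw [map_add, add_mul, hp, hq, eval_add, add_smul]
    | monomial n a =>
      rw [aeval_monomial, ← Algebra.smul_def, smul_mul_assoc, hpow, smul_smul, eval_monomial]
  have hsy : star y = y := rc_star_aeval hs g
  have hyy : y * y = (g.eval c) • y := hev g
  have hgc : g.eval c ≠ 0 := by
    intro hz
    rw [hz, zero_smul] at hyy
    apply hgh
    rw [← CStarRing.star_mul_self_eq_zero_iff, hsy, hyy]
  have hyh : y * h = c • y := by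
    have := congrArg star hhy
    simpa [hs, hsy] using this
  refine ⟨c, (g.eval c)⁻¹ • y, hc0, smul_ne_zero (inv_ne_zero hgc) hgh, ?_, ?_, ?_, ?_⟩
  · rw [smul_mul_smul_comm, hyy, smul_smul]
    congr 1
    field_simp
  · simp [hsy]
  · rw [mul_smul_comm, hhy, smul_comm]
  · rw [smul_mul_assoc, hyh, smul_comm]

/-- Minimal projections. -/
structure RcMin (e : A) : Prop where
  ne : e ≠ 0
  idem : e * e = e
  sa : star e = e
  min : ∀ q : A, q ≠ 0 → q * q = q → star q = q → e * q = q → q = e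

lemma rc_exists_min [FiniteDimensional ℝ A] : ∀ (N : ℕ) (p : A), p ≠ 0 → p * p = p → star p = p →
    Module.finrank ℝ (LinearMap.range (LinearMap.mulLeft ℝ p)) ≤ N →
    ∃ e : A, RcMin e ∧ p * e = e := by
  intro N
  induction N with
  | zero =>
    intro p hp hpp hps hN
    exfalso
    have h1 := Submodule.finrank_eq_zero.1 (Nat.le_zero.1 hN)
    apply hp
    have : p ∈ LinearMap.range (LinearMap.mulLeft ℝ p) := ⟨p, by simpa using hpp⟩
    rwa [h1, Submodule.mem_bot] at this
  | succ N ih =>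
    intro p hp hpp hps hN
    by_cases hmin : ∀ q : A, q ≠ 0 → q * q = q → star q = q → p * q = q → q = p
    · exact ⟨p, ⟨hp, hpp, hps, hmin⟩, hpp⟩
    · push Not at hmin
      obtain ⟨q, hq, hqq, hqs, hpq, hne⟩ := hmin
      have hlt : LinearMap.range (LinearMap.mulLeft ℝ q) < LinearMap.range (LinearMap.mulLeft ℝ p) := by
        refine lt_of_le_of_ne ?_ ?_
        · rintro _ ⟨x, rfl⟩
          exact ⟨q * x, by simp [← mul_assoc, hpq]⟩
        · intro heq
          have : p ∈ LinearMap.range (LinearMap.mulLeft ℝ p) := ⟨p, by simpa using hpp⟩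
          rw [← heq] at this
          obtain ⟨x, hx⟩ := this
          simp only [LinearMap.mulLeft_apply] at hx
          apply hne
          have h1 : q * p = p := by rw [← hx, ← mul_assoc, hqq]
          have h2 : q * p = q := by
            have := congrArg star hpq
            simpa [hps, hqs] using this
          rw [← h2, h1]
      have := Submodule.finrank_lt_finrank_of_lt hlt
      obtain ⟨e, he, hqe⟩ := ih q hq hqq hqs (by omega)
      exact ⟨e, he, by rw [← hqe, ← mul_assoc, hpq]⟩

lemma RcMin.scalar [FiniteDimensional ℝ A] (hinv : ∀ x : A, IsUnit (1 + star x * x)) {e : A}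
    (he : RcMin e) {h : A} (hs : star h = h) (heh : e * h = h) : ∃ c : ℝ, h = c • e := by
  by_cases h0 : h = 0
  · exact ⟨0, by simp [h0]⟩
  obtain ⟨c, q, hc, hq, hqq, hqs, hhq, hqh⟩ := rc_spectral hinv hs h0
  have hq' : q = c⁻¹ • (h * q) := by rw [hhq, smul_smul, inv_mul_cancel₀ hc, one_smul]
  have heq : e * q = q := by
    rw [hq', mul_smul_comm, ← mul_assoc, heh]
  have := he.min q hq hqq hqs heq
  subst this
  exact ⟨c, by rw [← hqh, heh]⟩

lemma RcMin.pos [FiniteDimensional ℝ A] (hinv : ∀ x : A, IsUnit (1 + star x * x)) {e : A}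
    (he : RcMin e) {x : A} (hx : x * e = x) (hx0 : x ≠ 0) :
    ∃ c : ℝ, 0 < c ∧ star x * x = c • e := by
  have h1 : e * star x = star x := by
    have := congrArg star hx
    simpa [he.sa] using this
  obtain ⟨c, hc⟩ := he.scalar hinv (h := star x * x) (by simp) (by rw [← mul_assoc, h1])
  refine ⟨c, ?_, hc⟩
  by_contra hneg
  push Not at hneg
  rcases hneg.lt_or_eq with hlt | rfl
  · have hpos : 0 < -c := by linarith
    have hu := hinv ((Real.sqrt (-c))⁻¹ • x)
    rw [star_smul, star_trivial, smul_mul_smul_comm, hc, smul_smul] at hu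
    have h2 : (Real.sqrt (-c))⁻¹ * (Real.sqrt (-c))⁻¹ * c = -1 := by
      rw [← mul_inv, Real.mul_self_sqrt hpos.le]
      rw [inv_neg, neg_mul, inv_mul_cancel₀ hlt.ne]
    rw [h2] at hu
    apply he.ne
    apply (hu.mul_right_eq_zero).1
    simp [add_mul, he.idem]
  · apply hx0
    rw [← CStarRing.star_mul_self_eq_zero_iff, hc, zero_smul]

/-- normalisation -/
lemma RcMin.normalize [FiniteDimensional ℝ A] (hinv : ∀ x : A, IsUnit (1 + star x * x)) {e : A}
    (he : RcMin e) {x : A} (hx : x * e = x) (hx0 : x ≠ 0) :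
    ∃ c : ℝ, c ≠ 0 ∧ star (c • x) * (c • x) = e := by
  obtain ⟨c, hc, h⟩ := he.pos hinv hx hx0
  refine ⟨(Real.sqrt c)⁻¹, by positivity, ?_⟩
  rw [star_smul, star_trivial, smul_mul_smul_comm, h, smul_smul, ← mul_inv, Real.mul_self_sqrt hc.le,
    inv_mul_cancel₀ hc.ne', one_smul]


/-- `D` is star-isomorphic to the corner `e A e`. -/
def RcCoord (D : Type) [Ring D] [StarRing D] [Algebra ℝ D] (e : A) : Prop :=
  ∃ ι : D →ₗ[ℝ] A, Function.Injective ι ∧ (∀ x y, ι (x * y) = ι x * ι y) ∧ ι 1 = e ∧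
    (∀ x, ι (star x) = star (ι x)) ∧ ∀ a : A, e * a = a → a * e = a → ∃ x, ι x = a

lemma rc_inj {D : Type} [DivisionRing D] [Algebra ℝ D] {e : A} (he : e ≠ 0) (ι : D →ₗ[ℝ] A)
    (hm : ∀ x y, ι (x * y) = ι x * ι y) (h1 : ι 1 = e) : Function.Injective ι := by
  rw [← LinearMap.ker_eq_bot, LinearMap.ker_eq_bot']
  intro x hx
  by_contra h0
  apply he
  rw [← h1, ← mul_inv_cancel₀ h0, hm, hx, zero_mul]

lemma rc_coord_real {e : A} (he : RcMin e) (H : ∀ a : A, e * a = a → a * e = a → ∃ c : ℝ, a = c • e) :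
    RcCoord ℝ e := by
  let ι : ℝ →ₗ[ℝ] A := LinearMap.toSpanSingleton ℝ A e
  have hι : ∀ x, ι x = x • e := fun x => rfl
  have hm : ∀ x y, ι (x * y) = ι x * ι y := by
    intro x y
    simp only [hι, smul_mul_smul_comm, he.idem]
  have h1 : ι 1 = e := by simp [hι]
  refine ⟨ι, rc_inj he.ne ι hm h1, hm, h1, ?_, ?_⟩
  · intro x; simp [hι, he.sa]
  · intro a h2 h3
    obtain ⟨c, rfl⟩ := H a h2 h3
    exact ⟨c, rfl⟩

lemma rc_coord_complex {e i : A} (he : RcMin e) (hei : e * i = i) (hie : i * e = i)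
    (hii : i * i = -e) (hsi : star i = -i)
    (H : ∀ a : A, e * a = a → a * e = a → ∃ c d : ℝ, a = c • e + d • i) :
    RcCoord ℂ e := by
  let ι : ℂ →ₗ[ℝ] A :=
    { toFun := fun z => z.re • e + z.im • i
      map_add' := by intro x y; simp only [Complex.add_re, Complex.add_im]; module
      map_smul' := by
        intro c x
        simp only [Complex.smul_re, Complex.smul_im, smul_eq_mul, RingHom.id_apply]; module }
  have hι : ∀ z : ℂ, ι z = z.re • e + z.im • i := fun x => rfl
  have hm : ∀ x y, ι (x * y) = ι x * ι y := by
    intro x y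
    simp only [hι, Complex.mul_re, Complex.mul_im, add_mul, mul_add, smul_mul_smul_comm, he.idem,
      hei, hie, hii]
    module
  have h1 : ι 1 = e := by simp [hι]
  refine ⟨ι, rc_inj he.ne ι hm h1, hm, h1, ?_, ?_⟩
  · intro x; simp [hι, he.sa, hsi]
  · intro a h2 h3
    obtain ⟨c, d, rfl⟩ := H a h2 h3
    exact ⟨⟨c, d⟩, rfl⟩

lemma rc_coord_quat {e i j k : A} (he : RcMin e) (hei : e * i = i) (hie : i * e = i)
    (hej : e * j = j) (hje : j * e = j) (hek : e * k = k) (hke : k * e = k)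
    (hii : i * i = -e) (hjj : j * j = -e) (hkk : k * k = -e)
    (hij : i * j = k) (hji : j * i = -k) (hjk : j * k = i) (hkj : k * j = -i)
    (hki : k * i = j) (hik : i * k = -j)
    (hsi : star i = -i) (hsj : star j = -j) (hsk : star k = -k)
    (H : ∀ a : A, e * a = a → a * e = a → ∃ c d f g : ℝ, a = c • e + d • i + f • j + g • k) :
    RcCoord (Quaternion ℝ) e := by
  let ι : Quaternion ℝ →ₗ[ℝ] A :=
    { toFun := fun z => z.re • e + z.imI • i + z.imJ • j + z.imK • k
      map_add' := by
        intro x y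
        simp only [Quaternion.re_add, Quaternion.imI_add, Quaternion.imJ_add, Quaternion.imK_add]
        module
      map_smul' := by
        intro c x
        simp only [Quaternion.re_smul, Quaternion.imI_smul, Quaternion.imJ_smul,
          Quaternion.imK_smul, smul_eq_mul, RingHom.id_apply]
        module }
  have hι : ∀ z : Quaternion ℝ, ι z = z.re • e + z.imI • i + z.imJ • j + z.imK • k := fun x => rfl
  have hm : ∀ x y, ι (x * y) = ι x * ι y := by
    intro x y
    simp only [hι, Quaternion.re_mul, Quaternion.imI_mul, Quaternion.imJ_mul, Quaternion.imK_mul,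
      add_mul, mul_add, smul_mul_smul_comm, he.idem,
      hei, hie, hej, hje, hek, hke, hii, hjj, hkk, hij, hji, hjk, hkj, hki, hik]
    module
  have h1 : ι 1 = e := by
    simp [hι, Quaternion.re_one, Quaternion.imI_one, Quaternion.imJ_one, Quaternion.imK_one]
  refine ⟨ι, rc_inj he.ne ι hm h1, hm, h1, ?_, ?_⟩
  · intro x; simp [hι, he.sa, hsi, hsj, hsk]
  · intro a h2 h3
    obtain ⟨c, d, f, g, rfl⟩ := H a h2 h3
    exact ⟨⟨c, d, f, g⟩, rfl⟩

/-- Imaginary elements of the corner. -/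
structure RcIm (e x : A) : Prop where
  l : e * x = x
  r : x * e = x
  s : star x = -x

lemma RcIm.add {e x y : A} (hx : RcIm e x) (hy : RcIm e y) : RcIm e (x + y) :=
  ⟨by rw [mul_add, hx.l, hy.l], by rw [add_mul, hx.r, hy.r], by rw [star_add, hx.s, hy.s]; abel⟩

lemma RcIm.smul {e x : A} (hx : RcIm e x) (c : ℝ) : RcIm e (c • x) :=
  ⟨by rw [mul_smul_comm, hx.l], by rw [smul_mul_assoc, hx.r], by
    rw [star_smul, hx.s, star_trivial, smul_neg]⟩

variable [FiniteDimensional ℝ A]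

lemma RcMin.anti (hinv : ∀ x : A, IsUnit (1 + star x * x)) {e : A}
    (he : RcMin e) {x y : A} (hx : RcIm e x) (hy : RcIm e y) :
    ∃ c : ℝ, x * y + y * x = (2 * c) • e := by
  obtain ⟨c, hc⟩ := he.scalar hinv (h := x * y + y * x)
    (by rw [star_add, star_mul, star_mul, hx.s, hy.s]; simp only [neg_mul_neg]; abel)
    (by rw [mul_add, ← mul_assoc, ← mul_assoc, hx.l, hy.l])
  exact ⟨c / 2, by rw [hc]; congr 1; ring⟩

lemma RcMin.unitIm (hinv : ∀ x : A, IsUnit (1 + star x * x)) {e : A}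
    (he : RcMin e) {x : A} (hx : RcIm e x) (hx0 : x ≠ 0) :
    ∃ c : ℝ, c ≠ 0 ∧ (c • x) * (c • x) = -e := by
  obtain ⟨c, hc, h⟩ := he.normalize hinv hx.r hx0
  refine ⟨c, hc, ?_⟩
  rw [(hx.smul c).s, neg_mul] at h
  rw [← h, neg_neg]

lemma RcMin.decomp (hinv : ∀ x : A, IsUnit (1 + star x * x)) {e : A}
    (he : RcMin e) {a : A} (h1 : e * a = a) (h2 : a * e = a) :
    ∃ (c : ℝ) (x : A), RcIm e x ∧ a = c • e + x := by
  have h3 : e * star a = star a := by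
    have := congrArg star h2
    simpa [he.sa] using this
  have h4 : star a * e = star a := by
    have := congrArg star h1
    simpa [he.sa] using this
  obtain ⟨c, hc⟩ := he.scalar hinv (h := (1 / 2 : ℝ) • (a + star a))
    (by rw [star_smul, star_trivial, star_add, star_star, add_comm])
    (by rw [mul_smul_comm, mul_add, h1, h3])
  refine ⟨c, (1 / 2 : ℝ) • (a - star a), ⟨?_, ?_, ?_⟩, ?_⟩
  · rw [mul_smul_comm, mul_sub, h1, h3]
  · rw [smul_mul_assoc, sub_mul, h2, h4]
  · rw [star_smul, star_trivial, star_sub, star_star]; module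
  · rw [← hc]; module

lemma RcMin.coord (hinv : ∀ x : A, IsUnit (1 + star x * x)) {e : A} (he : RcMin e) :
    RcCoord ℝ e ∨ RcCoord ℂ e ∨ RcCoord (Quaternion ℝ) e := by
  by_cases hI : ∀ x, RcIm e x → x = 0
  · left
    apply rc_coord_real he
    intro a h1 h2
    obtain ⟨c, x, hx, rfl⟩ := he.decomp hinv h1 h2
    exact ⟨c, by rw [hI x hx, add_zero]⟩
  right
  push Not at hI
  obtain ⟨i₀, hi₀, hne⟩ := hI
  obtain ⟨c, hc, hii⟩ := he.unitIm hinv hi₀ hne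
  have hi := hi₀.smul c
  generalize c • i₀ = i at hi hii
  by_cases hJ : ∀ x, RcIm e x → ∃ c : ℝ, x = c • i
  · left
    apply rc_coord_complex he hi.l hi.r hii hi.s
    intro a h1 h2
    obtain ⟨c, x, hx, rfl⟩ := he.decomp hinv h1 h2
    obtain ⟨d, rfl⟩ := hJ x hx
    exact ⟨c, d, rfl⟩
  right
  push Not at hJ
  obtain ⟨y, hy, hyi⟩ := hJ
  -- orthogonalisation step
  have key : ∀ x u, RcIm e x → RcIm e u → u * u = -e →
      ∃ c : ℝ, u * (x + c • u) = - ((x + c • u) * u) := by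
    intro x u hx hu huu
    obtain ⟨c, hc⟩ := he.anti hinv hu hx
    refine ⟨c, ?_⟩
    rw [← add_eq_zero_iff_eq_neg, mul_add, add_mul, mul_smul_comm, smul_mul_assoc, huu]
    have : u * x + c • -e + (x * u + c • -e) = (u * x + x * u) + (2 * c) • -e := by module
    rw [this, hc]; module
  obtain ⟨c, hcj⟩ := key y i hy hi hii
  have hj₁ := hy.add (hi.smul c)
  have hj0 : y + c • i ≠ 0 := by
    intro h
    apply hyi (-c)
    rw [neg_smul]; exact eq_neg_of_add_eq_zero_left h
  obtain ⟨d, hd, hjj⟩ := he.unitIm hinv hj₁ hj0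
  have hj := hj₁.smul d
  have hij' : i * (d • (y + c • i)) = -((d • (y + c • i)) * i) := by
    rw [mul_smul_comm, smul_mul_assoc, hcj, smul_neg]
  generalize d • (y + c • i) = j at hj hjj hij'
  have hji : j * i = -(i * j) := by rw [hij', neg_neg]
  obtain ⟨k, hk⟩ : ∃ k, k = i * j := ⟨_, rfl⟩
  have hik : i * k = -j := by rw [hk, ← mul_assoc, hii, neg_mul, hj.l]
  have hkj : k * j = -i := by rw [hk, mul_assoc, hjj, mul_neg, hi.r]
  have hki : k * i = j := by rw [hk, mul_assoc, hji, mul_neg, ← hk, hik, neg_neg]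
  have hjk : j * k = i := by rw [hk, ← mul_assoc, hji, neg_mul, ← hk, hkj, neg_neg]
  have hkk : k * k = -e := by
    nth_rewrite 2 [hk]
    rw [← mul_assoc, hki, hjj]
  have hkI : RcIm e k := by
    refine ⟨?_, ?_, ?_⟩
    · rw [hk, ← mul_assoc, hi.l]
    · rw [hk, mul_assoc, hj.r]
    · rw [hk, star_mul, hi.s, hj.s, neg_mul_neg, hji]
  refine rc_coord_quat he hi.l hi.r hj.l hj.r hkI.l hkI.r hii hjj hkk hk.symm (by rw [hji, hk])
    hjk hkj hki hik hi.s hj.s hkI.s ?_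
  intro a h1 h2
  obtain ⟨r, x, hx, rfl⟩ := he.decomp hinv h1 h2
  obtain ⟨a1, ha1⟩ := key x i hx hi hii
  have hx1 := hx.add (hi.smul a1)
  obtain ⟨a2, ha2⟩ := key _ j hx1 hj hjj
  have hx2 := hx1.add (hj.smul a2)
  obtain ⟨a3, ha3⟩ := key _ k hx2 hkI hkk
  obtain ⟨z, hz⟩ : ∃ z, z = x + a1 • i + a2 • j + a3 • k := ⟨_, rfl⟩
  have hzI : RcIm e z := hz ▸ hx2.add (hkI.smul a3)
  have e1 : i * z = -(z * i) := by
    have : i * (a2 • j + a3 • k) = -((a2 • j + a3 • k) * i) := by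
      simp only [mul_add, add_mul, mul_smul_comm, smul_mul_assoc, hik, hki, hji]; module
    rw [hz, add_assoc, mul_add, add_mul, this, ha1]; abel
  have e2 : j * z = -(z * j) := by
    have : j * (a3 • k) = -((a3 • k) * j) := by
      simp only [mul_smul_comm, smul_mul_assoc, hjk, hkj]; module
    rw [hz, mul_add, add_mul, this, ha2]; abel
  have e3 : k * z = -(z * k) := by rw [hz]; exact ha3
  have e4 : k * z = z * k := by
    rw [hk, mul_assoc, e2, mul_neg, ← mul_assoc, e1, neg_mul, neg_neg, mul_assoc]
  have e5 : z * k = 0 := by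
    have h5 : z * k = -(z * k) := by rw [← e3, e4]
    have h6 : (2 : ℝ) • (z * k) = 0 := by
      rw [two_smul]; nth_rewrite 2 [h5]; exact add_neg_cancel _
    exact (smul_eq_zero.1 h6).resolve_left two_ne_zero
  have e6 : z = 0 := by
    have : z * k * k = 0 := by rw [e5, zero_mul]
    rw [mul_assoc, hkk, mul_neg, hzI.r] at this
    exact neg_eq_zero.1 this
  refine ⟨r, -a1, -a2, -a3, ?_⟩
  have : x = z - a1 • i - a2 • j - a3 • k := by rw [hz]; abel
  rw [this, e6]; module

lemma rc_maximal (P : ℕ → Prop) (N : ℕ) (h0 : P 0) (hN : ∀ n, P n → n ≤ N) :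
    ∃ n, P n ∧ ¬ P (n + 1) := by
  by_contra! h
  have : ∀ n, P n := fun n => by
    induction n with
    | zero => exact h0
    | succ n ih => exact h n ih
  have := hN _ (this (N + 1))
  omega

lemma rc_frame (hinv : ∀ x : A, IsUnit (1 + star x * x)) {e : A} (he : RcMin e) :
    ∃ (n : ℕ) (v : Fin n → A), (∀ i, v i * e = v i) ∧
      (∀ i j, star (v i) * v j = if i = j then e else 0) ∧
      ∀ x : A, (∑ i, v i * star (v i)) * (x * e) = x * e := by
  obtain ⟨n, ⟨v, hv1, hv2⟩, hmax⟩ := rc_maximal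
    (fun n => ∃ v : Fin n → A, (∀ i, v i * e = v i) ∧
      (∀ i j, star (v i) * v j = if i = j then e else 0)) (Module.finrank ℝ A)
    ⟨fun i => i.elim0, fun i => i.elim0, fun i => i.elim0⟩ (by
      rintro n ⟨v, hv1, hv2⟩
      have hli : LinearIndependent ℝ v := by
        rw [Fintype.linearIndependent_iff]
        intro g hg j
        have h := congrArg (fun t => star (v j) * t) hg
        simp only [Finset.mul_sum, mul_smul_comm, hv2, mul_zero, smul_ite, smul_zero,
          Finset.sum_ite_eq, Finset.mem_univ, if_true] at h
        exact (smul_eq_zero.1 h).resolve_right he.ne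
      simpa using hli.fintype_card_le_finrank)
  refine ⟨n, v, hv1, hv2, ?_⟩
  intro x
  by_contra hne
  apply hmax
  have hy0 : x * e - (∑ i, v i * star (v i)) * (x * e) ≠ 0 := fun h => hne (sub_eq_zero.1 h).symm
  have hye : (x * e - (∑ i, v i * star (v i)) * (x * e)) * e
      = x * e - (∑ i, v i * star (v i)) * (x * e) := by
    simp only [sub_mul, mul_assoc, he.idem]
  have hvy : ∀ j, star (v j) * (x * e - (∑ i, v i * star (v i)) * (x * e)) = 0 := by
    intro j
    have h1 : e * star (v j) = star (v j) := by
      have := congrArg star (hv1 j)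
      simpa [he.sa] using this
    have h2 : star (v j) * (∑ i, v i * star (v i)) = star (v j) := by
      simp only [Finset.mul_sum, ← mul_assoc, hv2, ite_mul, zero_mul, Finset.sum_ite_eq,
        Finset.mem_univ, if_true, h1]
    rw [mul_sub, ← mul_assoc _ _ (x * e), h2, sub_self]
  generalize x * e - (∑ i, v i * star (v i)) * (x * e) = y at hy0 hye hvy
  obtain ⟨c, hc, hcy⟩ := he.normalize hinv hye hy0
  have hvz : ∀ j, star (v j) * (c • y) = 0 := fun j => by rw [mul_smul_comm, hvy, smul_zero]
  have hzv : ∀ j, star (c • y) * v j = 0 := fun j => by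
    have := congrArg star (hvz j)
    simpa only [star_mul, star_star, star_zero] using this
  refine ⟨Fin.cons (c • y) v, ?_, ?_⟩
  · intro i
    refine Fin.cases ?_ (fun i => ?_) i
    · simp only [Fin.cons_zero, smul_mul_assoc, hye]
    · simp only [Fin.cons_succ, hv1]
  · intro i j
    refine Fin.cases ?_ (fun i => ?_) i <;> refine Fin.cases ?_ (fun j => ?_) j
    · simp only [Fin.cons_zero, hcy, if_true]
    · simp only [Fin.cons_zero, Fin.cons_succ, hzv, (Fin.succ_ne_zero j).symm, if_false]
    · simp only [Fin.cons_zero, Fin.cons_succ, hvz, Fin.succ_ne_zero i, if_false]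
    · simp only [Fin.cons_succ, hv2, Fin.succ_inj]

lemma rc_family (hinv : ∀ x : A, IsUnit (1 + star x * x)) :
    ∃ (k : ℕ) (e : Fin k → A), (∀ l, RcMin (e l)) ∧
      (∀ l m, l ≠ m → ∀ a, e l * a * e m = 0) ∧
      ∀ a : A, (∀ l x, a * (x * e l) = 0) → a = 0 := by
  obtain ⟨k, ⟨e, he1, he2⟩, hmax⟩ := rc_maximal
    (fun k => ∃ e : Fin k → A, (∀ l, RcMin (e l)) ∧ (∀ l m, l ≠ m → ∀ a, e l * a * e m = 0))
    (Module.finrank ℝ A)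
    ⟨fun i => i.elim0, fun i => i.elim0, fun i => i.elim0⟩ (by
      rintro n ⟨e, he1, he2⟩
      have he3 : ∀ l m, e l * e m = if l = m then e l else 0 := by
        intro l m
        split_ifs with h
        · rw [← h, (he1 l).idem]
        · simpa using he2 l m h 1
      have hli : LinearIndependent ℝ e := by
        rw [Fintype.linearIndependent_iff]
        intro g hg j
        have h := congrArg (fun t => e j * t) hg
        simp only [Finset.mul_sum, mul_smul_comm, he3, mul_zero, smul_ite, smul_zero,
          Finset.sum_ite_eq, Finset.mem_univ, if_true] at h
        exact (smul_eq_zero.1 h).resolve_right (he1 j).ne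
      simpa using hli.fintype_card_le_finrank)
  refine ⟨k, e, he1, he2, ?_⟩
  intro a ha
  by_contra ha0
  apply hmax
  have hh0 : star a * a ≠ 0 := by rwa [Ne, CStarRing.star_mul_self_eq_zero_iff]
  obtain ⟨c, q, hc, hq, hqq, hqs, hhq, hqh⟩ := rc_spectral hinv (h := star a * a) (by simp) hh0
  obtain ⟨f, hf, hqf⟩ := rc_exists_min _ q hq hqq hqs le_rfl
  have hfq : f * q = f := by
    have := congrArg star hqf
    simpa [hf.sa, hqs] using this
  have hf1 : ∀ l x, f * x * e l = 0 := by
    intro l x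
    have h1 : q * (x * e l) = 0 := by
      have : q = c⁻¹ • (q * (star a * a)) := by
        rw [hqh, smul_smul, inv_mul_cancel₀ hc, one_smul]
      rw [this, smul_mul_assoc, mul_assoc, mul_assoc, ha, mul_zero, mul_zero, smul_zero]
    rw [← hfq, mul_assoc, mul_assoc, h1, mul_zero]
  have hf2 : ∀ l x, e l * x * f = 0 := by
    intro l x
    have := congrArg star (hf1 l (star x))
    simpa [hf.sa, (he1 l).sa, mul_assoc] using this
  refine ⟨Fin.cons f e, ?_, ?_⟩
  · intro i
    refine Fin.cases ?_ (fun i => ?_) i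
    · simpa using hf
    · simpa using he1 i
  · intro i j
    refine Fin.cases ?_ (fun i => ?_) i <;> refine Fin.cases ?_ (fun j => ?_) j
    · intro h; exact absurd rfl h
    · intro _ a; simp only [Fin.cons_zero, Fin.cons_succ, hf1]
    · intro _ a; simp only [Fin.cons_zero, Fin.cons_succ, hf2]
    · intro h a
      simp only [Fin.cons_succ]
      exact he2 i j (fun hh => h (by rw [hh])) a

lemma RcMin.exists_type (hinv : ∀ x : A, IsUnit (1 + star x * x)) {e : A} (he : RcMin e) :
    ∃ d : RCHType, RcCoord d.carrier e := by
  rcases he.coord hinv with h | h | h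
  · exact ⟨.R, h⟩
  · exact ⟨.C, h⟩
  · exact ⟨.H, h⟩

set_option maxHeartbeats 1000000 in
lemma rc_main (hinv : ∀ x : A, IsUnit (1 + star x * x)) :
    ∃ (k : ℕ) (n : Fin k → ℕ) (D : Fin k → RCHType),
      Nonempty (A ≃⋆ₐ[ℝ] Π i : Fin k, Matrix (Fin (n i)) (Fin (n i)) (D i).carrier) := by
  obtain ⟨k, e, he, hort, hker⟩ := rc_family hinv
  choose D ι hιinj hιmul hιone hιstar hιsurj using fun l => (he l).exists_type hinv
  choose n v hve hvv hvP using fun l => rc_frame hinv (he l)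
  refine ⟨k, n, D, ?_⟩
  have hev : ∀ l i, e l * star (v l i) = star (v l i) := by
    intro l i
    have := congrArg star (hve l i)
    simpa [(he l).sa] using this
  have hιl : ∀ l x, e l * ι l x = ι l x := by
    intro l x; rw [← hιone, ← hιmul, one_mul]
  have hιr : ∀ l x, ι l x * e l = ι l x := by
    intro l x; rw [← hιone, ← hιmul, mul_one]
  have hvort : ∀ l m, l ≠ m → ∀ i j a, star (v l i) * a * v m j = 0 := by
    intro l m hlm i j a
    have : star (v l i) * a * v m j = e l * (star (v l i) * a * v m j) * e m := by
      rw [mul_assoc _ _ (e m), mul_assoc _ _ (e m), hve, ← mul_assoc, ← mul_assoc, hev]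
    rw [this, hort l m hlm]
  let Ψ : (Π l : Fin k, Matrix (Fin (n l)) (Fin (n l)) (D l).carrier) → A :=
    fun M => ∑ l, ∑ i, ∑ j, v l i * ι l (M l i j) * star (v l j)
  -- multiplication against frame vectors
  have hvΨ : ∀ M m i, star (v m i) * Ψ M = ∑ j, ι m (M m i j) * star (v m j) := by
    intro M m i
    have hl : ∀ l, star (v m i) * (∑ i2, ∑ j, v l i2 * ι l (M l i2 j) * star (v l j))
        = if m = l then ∑ j, ι m (M m i j) * star (v m j) else 0 := by
      intro l
      split_ifs with h
      · subst h
        simp only [Finset.mul_sum, ← mul_assoc, hvv, ite_mul, zero_mul]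
        rw [Finset.sum_comm]
        simp only [Finset.sum_ite_eq, Finset.mem_univ, if_true, hιl]
      · have := fun i2 => hvort m l h i i2 1
        simp only [mul_one] at this
        simp only [Finset.mul_sum, ← mul_assoc, this, zero_mul, Finset.sum_const_zero]
    simp only [Ψ]
    rw [Finset.mul_sum]
    simp only [hl, Finset.sum_ite_eq, Finset.mem_univ, if_true]
  have hvΨv : ∀ M m i j, star (v m i) * Ψ M * v m j = ι m (M m i j) := by
    intro M m i j
    rw [hvΨ, Finset.sum_mul]
    simp only [mul_assoc, hvv, mul_ite, mul_zero, Finset.sum_ite_eq', Finset.mem_univ, if_true, hιr]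
  have hinj : Function.Injective Ψ := by
    intro M N h
    funext l
    ext i j
    apply hιinj l
    rw [← hvΨv, ← hvΨv, h]
  -- the identity decomposes
  have hP : ∑ l, ∑ i, v l i * star (v l i) = 1 := by
    rw [← sub_eq_zero]
    apply hker
    intro m x
    have hl : ∀ l, (∑ i, v l i * star (v l i)) * (x * e m) = if l = m then x * e m else 0 := by
      intro l
      split_ifs with h
      · subst h; exact hvP l x
      · rw [Finset.sum_mul]
        apply Finset.sum_eq_zero
        intro i _
        have : v l i * star (v l i) * (x * e m) = v l i * (e l * (star (v l i) * x) * e m) := by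
          rw [← mul_assoc (e l), hev]; simp only [mul_assoc]
        rw [this, hort l m h, mul_zero]
    rw [sub_mul, Finset.sum_mul]
    simp only [hl, Finset.sum_ite_eq', Finset.mem_univ, if_true, one_mul, sub_self]
  have hsurj : Function.Surjective Ψ := by
    intro a
    have : ∀ l i j, ∃ x, ι l x = star (v l i) * a * v l j := by
      intro l i j
      apply hιsurj
      · rw [← mul_assoc, ← mul_assoc, hev]
      · rw [mul_assoc, hve]
    choose M hM using this
    refine ⟨fun l => Matrix.of (M l), ?_⟩
    have h1 : a = (∑ l, ∑ i, v l i * star (v l i)) * a * (∑ l, ∑ i, v l i * star (v l i)) := by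
      rw [hP, one_mul, mul_one]
    rw [h1]
    simp only [Ψ, Matrix.of_apply, hM]
    rw [Finset.sum_mul, Finset.sum_mul]
    apply Finset.sum_congr rfl
    intro l _
    rw [Finset.sum_mul, Finset.sum_mul]
    apply Finset.sum_congr rfl
    intro i _
    rw [Finset.mul_sum, Finset.sum_eq_single l]
    · rw [Finset.mul_sum]
      apply Finset.sum_congr rfl
      intro j _
      simp only [mul_assoc]
    · intro m _ hm
      rw [Finset.mul_sum]
      apply Finset.sum_eq_zero
      intro j _
      have := hvort l m hm.symm i j a
      calc _ = v l i * (star (v l i) * a * v m j) * star (v m j) := by simp only [mul_assoc]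
        _ = 0 := by rw [this, mul_zero, zero_mul]
    · simp
  have hadd : ∀ M N, Ψ (M + N) = Ψ M + Ψ N := by
    intro M N
    simp only [Ψ, Pi.add_apply, Matrix.add_apply, map_add, mul_add, add_mul, Finset.sum_add_distrib]
  have hsmul : ∀ (c : ℝ) M, Ψ (c • M) = c • Ψ M := by
    intro c M
    simp only [Ψ, Pi.smul_apply, Matrix.smul_apply, map_smul, mul_smul_comm, smul_mul_assoc,
      Finset.smul_sum]
  have hmul : ∀ M N, Ψ (M * N) = Ψ M * Ψ N := by
    intro M N
    have h1 : ∀ T : A, Ψ M * T = ∑ l, ∑ i, ∑ j, v l i * ι l (M l i j) * (star (v l j) * T) := by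
      intro T
      simp only [Ψ, Finset.sum_mul, mul_assoc]
    rw [h1]
    simp only [hvΨ]
    simp only [Ψ, Pi.mul_apply, Matrix.mul_apply, map_sum, hιmul, Finset.mul_sum, Finset.sum_mul]
    apply Finset.sum_congr rfl
    intro l _
    apply Finset.sum_congr rfl
    intro i _
    rw [Finset.sum_comm]
    simp only [mul_assoc]
  have hstar : ∀ M, Ψ (star M) = star (Ψ M) := by
    intro M
    simp only [Ψ, Pi.star_apply, Matrix.star_apply, hιstar, star_sum, star_mul, star_star]
    apply Finset.sum_congr rfl
    intro l _
    rw [Finset.sum_comm]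
    simp only [mul_assoc]
  let E : (Π l : Fin k, Matrix (Fin (n l)) (Fin (n l)) (D l).carrier) ≃⋆ₐ[ℝ] A :=
    { Equiv.ofBijective Ψ ⟨hinj, hsurj⟩ with
      map_add' := hadd
      map_mul' := hmul
      map_smul' := hsmul
      map_star' := hstar }
  exact ⟨E.symm⟩

end RealCStar

/-- A finite-dimensional real C*-algebra is star-isomorphic (over `ℝ`) to a finite product
of matrix algebras over `ℝ`, `ℂ` or `ℍ`, each matrix algebra carrying the
conjugate-transpose star. -/
theorem finiteDimensional_real_cstarAlgebra_classification
    {A : Type*} [NormedRing A] [StarRing A] [CStarRing A] [NormedAlgebra ℝ A]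
    [StarModule ℝ A] [CompleteSpace A] [FiniteDimensional ℝ A]
    (hinv : ∀ x : A, IsUnit (1 + star x * x)) :
    ∃ (k : ℕ) (n : Fin k → ℕ) (D : Fin k → RCHType),
      Nonempty (A ≃⋆ₐ[ℝ] Π i : Fin k, Matrix (Fin (n i)) (Fin (n i)) (D i).carrier) := by
  exact rc_main hinv
end

section
/- Let B be a unital complex C*-algebra and let J : B → B be a conjugate-linear *-isomorphism which is an involution: J is additive, J (c • x) = (starRingEnd ℂ c) • J x for all c ∈ ℂ, J (x * y) = J x * J y, J (star x) = star (J x), and J (J x) = x for all x, y ∈ B. Then the fixed-point set F = { x ∈ B | J x = x } is a topologically closed subset of B, is closed under addition, multiplication, star, and ℝ-scalar multiplication, contains 1, and for every x ∈ F the element 1 + star x * x is invertible in B with inverse belonging to F. (Hence F is a real C*-algebra.) -/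
/-- The fixed-point set of a conjugate-linear star-involution `J` of a unital complex
C*-algebra `B` is a closed subset, closed under addition, multiplication, star, and
real scalar multiplication, contains `1`, and for each fixed point `x` the element
`1 + star x * x` is invertible in `B` with inverse again a fixed point.
Hence it is a real C*-algebra. -/
theorem fixedPoints_conjugateLinear_star_involution_real_cstar
    {B : Type*} [NormedRing B] [StarRing B] [CStarRing B] [CompleteSpace B]
    [NormedAlgebra ℂ B] [StarModule ℂ B]
    (J : B → B)
    (hadd : ∀ x y : B, J (x + y) = J x + J y)
    (hsmul : ∀ (c : ℂ) (x : B), J (c • x) = (starRingEnd ℂ c) • J x)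
    (hmul : ∀ x y : B, J (x * y) = J x * J y)
    (hstar : ∀ x : B, J (star x) = star (J x))
    (hinvol : ∀ x : B, J (J x) = x) :
    IsClosed {x : B | J x = x} ∧
    (∀ x y : B, J x = x → J y = y → J (x + y) = x + y) ∧
    (∀ x y : B, J x = x → J y = y → J (x * y) = x * y) ∧
    (∀ x : B, J x = x → J (star x) = star x) ∧
    (∀ (r : ℝ) (x : B), J x = x → J (r • x) = r • x) ∧
    J 1 = 1 ∧
    (∀ x : B, J x = x →
      ∃ y : B, J y = y ∧ (1 + star x * x) * y = 1 ∧ y * (1 + star x * x) = 1) := by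
  have h1 : J 1 = 1 := by
    have h := hmul 1 (J 1)
    rw [hinvol, one_mul, hinvol, mul_one] at h
    exact h.symm
  have hunit : ∀ a : B, IsUnit a → IsUnit (J a) := by
    rintro _ ⟨u, rfl⟩
    exact ⟨⟨J u, J (↑u⁻¹ : B), by rw [← hmul, u.mul_inv, h1], by rw [← hmul, u.inv_mul, h1]⟩, rfl⟩
  have hneg : ∀ x : B, J (-x) = -J x := by
    intro x
    have h := hsmul (-1) x
    simpa using h
  have hsub : ∀ x y : B, J (x - y) = J x - J y := by
    intro x y
    rw [sub_eq_add_neg, hadd, hneg, sub_eq_add_neg]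
  have hspec : ∀ b : B, spectralRadius ℂ (J b) ≤ spectralRadius ℂ b := by
    intro b
    unfold spectralRadius
    refine iSup₂_le fun k hk => ?_
    have hk2 : (starRingEnd ℂ k) ∈ spectrum ℂ b := by
      rw [spectrum.mem_iff] at hk ⊢
      intro hu
      apply hk
      have h := hunit _ hu
      rw [hsub, Algebra.algebraMap_eq_smul_one, hsmul, h1] at h
      simpa [Algebra.algebraMap_eq_smul_one] using h
    have h := le_iSup₂ (f := fun (k : ℂ) (_ : k ∈ spectrum ℂ b) => (‖k‖₊ : ENNReal)) _ hk2
    simpa using h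
  letI : CStarAlgebra B := {}
  have hnorm : ∀ a : B, ‖J a‖ ≤ ‖a‖ := by
    intro a
    have h := hspec (star a * a)
    rw [hmul, hstar, (IsSelfAdjoint.star_mul_self a).spectralRadius_eq_nnnorm,
      (IsSelfAdjoint.star_mul_self (J a)).spectralRadius_eq_nnnorm, ENNReal.coe_le_coe,
      ← NNReal.coe_le_coe, coe_nnnorm, coe_nnnorm, CStarRing.norm_star_mul_self,
      CStarRing.norm_star_mul_self] at h
    nlinarith [norm_nonneg (J a), norm_nonneg a]
  have hcont : Continuous J := by
    refine (LipschitzWith.of_dist_le_mul (K := 1) fun x y => ?_).continuous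
    rw [dist_eq_norm, dist_eq_norm, ← hsub]
    simpa using hnorm (x - y)
  refine ⟨isClosed_eq hcont continuous_id, ?_, ?_, ?_, ?_, h1, ?_⟩
  · intro x y hx hy
    rw [hadd, hx, hy]
  · intro x y hx hy
    rw [hmul, hx, hy]
  · intro x hx
    rw [hstar, hx]
  · intro r x hx
    have h := hsmul (r : ℂ) x
    rw [Complex.conj_ofReal, hx] at h
    simpa using h
  · intro x hx
    have hu : IsUnit (1 + star x * x) := by
      by_contra hn
      have hm : (-1 : ℝ) ∈ spectrum ℝ (star x * x) := by
        rw [spectrum.mem_iff]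
        intro hu
        apply hn
        have := hu.neg
        simpa [add_comm] using this
      have := spectrum_star_mul_self_nonneg _ hm
      linarith
    obtain ⟨u, hu⟩ := hu
    have hJu : J (u : B) = u := by
      rw [hu, hadd, hmul, hstar, hx, h1]
    refine ⟨(↑u⁻¹ : B), ?_, by rw [← hu, u.mul_inv], by rw [← hu, u.inv_mul]⟩
    have h : (u : B) * J (↑u⁻¹ : B) = 1 := by
      have h := hmul (u : B) (↑u⁻¹ : B)
      rw [u.mul_inv, h1, hJu] at h
      exact h.symm
    exact (Units.eq_inv_of_mul_eq_one_left h)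
end

section
/- Let H be a real Hilbert space, A a type, and ρ : A → (H →L[ℝ] H) a map. Suppose T and T' are bounded operators on H each satisfying the Fredholm-module conditions for ρ, and suppose T is a compact perturbation of T', i.e. (T - T') ∘L ρ a is a compact operator for every a : A. Then for every t ∈ [0,1] the operator T_t := (1 - t) • T + t • T' satisfies the Fredholm-module conditions for ρ; moreover the map t ↦ T_t is norm continuous. (Hence the two Fredholm modules are operator homotopic.) -/
open ContinuousLinearMap

/-- The Fredholm-module conditions for an operator `T` relative to a map
`ρ : A → (H →L[ℝ] H)`: for all `a`, the operators `(T² - 1) ρ(a)`, `(T - T*) ρ(a)` and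
`[T, ρ(a)]` are compact. -/
def FredholmModuleConditions {A : Type*} {H : Type*} [NormedAddCommGroup H]
    [InnerProductSpace ℝ H] [CompleteSpace H] (ρ : A → (H →L[ℝ] H))
    (T : H →L[ℝ] H) : Prop :=
  ∀ a : A,
    IsCompactOperator ⇑((T ∘L T - 1) ∘L ρ a) ∧
    IsCompactOperator ⇑((T - ContinuousLinearMap.adjoint T) ∘L ρ a) ∧
    IsCompactOperator ⇑(T ∘L ρ a - ρ a ∘L T)

lemma compactOperator_of_forall_eq {H : Type*} [NormedAddCommGroup H] {f g : H → H}
    (hf : IsCompactOperator f) (h : ∀ x, g x = f x) : IsCompactOperator g := by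
  rwa [funext h]

/-- If `T` and `T'` both satisfy the Fredholm-module conditions for `ρ` and `T` is a
compact perturbation of `T'`, then every operator `T_t = (1 - t) T + t T'` for
`t ∈ [0, 1]` satisfies the Fredholm-module conditions, and `t ↦ T_t` is norm continuous;
hence the two Fredholm modules are operator homotopic. -/
theorem fredholmModule_compact_perturbation_operatorHomotopy
    {A : Type*} {H : Type*} [NormedAddCommGroup H] [InnerProductSpace ℝ H]
    [CompleteSpace H] (ρ : A → (H →L[ℝ] H)) (T T' : H →L[ℝ] H)
    (hT : FredholmModuleConditions ρ T) (hT' : FredholmModuleConditions ρ T')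
    (hcpt : ∀ a : A, IsCompactOperator ⇑((T - T') ∘L ρ a)) :
    (∀ t ∈ Set.Icc (0 : ℝ) 1,
      FredholmModuleConditions ρ ((1 - t) • T + t • T')) ∧
    Continuous fun t : ℝ => (1 - t) • T + t • T' := by
  refine ⟨fun t _ a => ?_, by fun_prop⟩
  obtain ⟨h1, h2, h3⟩ := hT a
  obtain ⟨h1', h2', h3'⟩ := hT' a
  refine ⟨?_, ?_, ?_⟩
  · have hD : IsCompactOperator ⇑((T - T') ∘L ((T - T') ∘L ρ a)) :=
      (hcpt a).clm_comp (T - T')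
    have key := ((h1.smul (1 - t)).add (h1'.smul t)).sub (hD.smul ((1 - t) * t))
    refine compactOperator_of_forall_eq key fun x => ?_
    simp
    module
  · have key := (h2.smul (1 - t)).add (h2'.smul t)
    refine compactOperator_of_forall_eq key fun x => ?_
    simp
    module
  · have key := (h3.smul (1 - t)).add (h3'.smul t)
    refine compactOperator_of_forall_eq key fun x => ?_
    simp
    module
end

section
/- Let H be a real Hilbert space and T : H →L[ℝ] H a bounded linear operator. Then 1 + (ContinuousLinearMap.adjoint T) ∘L T is invertible in the ring of bounded operators on H, i.e. IsUnit (1 + ContinuousLinearMap.adjoint T ∘L T). -/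
/-- For any bounded operator `T` on a real Hilbert space `H`, the operator `1 + T* T` is
invertible in the algebra of bounded operators on `H`. -/
theorem isUnit_one_add_adjoint_comp_self {H : Type*} [NormedAddCommGroup H]
    [InnerProductSpace ℝ H] [CompleteSpace H] (T : H →L[ℝ] H) :
    IsUnit (1 + ContinuousLinearMap.adjoint T ∘L T) := by
  refine ContinuousLinearMap.isUnit_of_forall_le_norm_inner_map _ (c := 1) one_pos fun x => ?_
  have h : inner ℝ ((1 + ContinuousLinearMap.adjoint T ∘L T) x) x = ‖x‖ ^ 2 + ‖T x‖ ^ 2 := by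
    rw [ContinuousLinearMap.add_apply, inner_add_left, ContinuousLinearMap.comp_apply,
      ContinuousLinearMap.adjoint_inner_left, real_inner_self_eq_norm_sq]
    exact congrArg (· + _) (real_inner_self_eq_norm_sq x)
  rw [h, Real.norm_of_nonneg (by positivity), NNReal.coe_one, mul_one]
  exact le_add_of_nonneg_right (by positivity)
end
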